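/- For the morphism F = (f_1, f_2) : ℂ² → ℂ² with f_1 = y² − x² + x³ and f_2 = y, and a = (1,2), the Bernstein–Sato ideal B_F^a is the principal ideal of ℂ[s_1,s_2] generated by (s_1+1)(s_2+1)(s_2+2)·(2s_1+s_2+2)(2s_1+s_2+3)(2s_1+s_2+4)(2s_1+s_2+5). -/

import Mathlib

open MvPolynomial MeasureTheory

noncomputable section

/-- The polynomial ring `K0[x_1,…,x_n,s_1,…,s_r]`, with the `x`-variables indexed by
`Sum.inl` and the `s`-variables indexed by `Sum.inr`. -/
abbrev XS (K0 : Type) [Field K0] (n r : ℕ) : Type := MvPolynomial (Fin n ⊕ Fin r) K0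

/-- The fraction field of `K0[x,s]`; the localization `K0[x,s][1/f]` sits inside it, and the
smallest `∇`-stable submodule generated by an element is the same computed in either. -/
abbrev Frac (K0 : Type) [Field K0] (n r : ℕ) : Type := FractionRing (XS K0 n r)

variable (K0 : Type) [Field K0] (n r : ℕ)

/-- Embedding of `K0[x_1,…,x_n]` into `K0[x,s]`. -/
def px (p : MvPolynomial (Fin n) K0) : XS K0 n r := rename Sum.inl p

/-- Embedding of `K0[s_1,…,s_r]` into `K0[x,s]`. -/
def ps (p : MvPolynomial (Fin r) K0) : XS K0 n r := rename Sum.inr p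

/-- The canonical map from `K0[x,s]` to its fraction field. -/
def toF (p : XS K0 n r) : Frac K0 n r := algebraMap _ _ p

/-- The partial derivative `∂/∂x_i`, extended to the fraction field of `K0[x,s]` via the
quotient rule applied to a representative fraction (the formula is independent of the chosen
representative, so this is the unique derivation extending `pderiv (Sum.inl i)`). -/
def DX (i : Fin n) (q : Frac K0 n r) : Frac K0 n r :=
  let h := IsFractionRing.div_surjective (A := XS K0 n r) q
  (toF K0 n r (pderiv (Sum.inl i) h.choose) * toF K0 n r h.choose_spec.choose -
      toF K0 n r h.choose * toF K0 n r (pderiv (Sum.inl i) h.choose_spec.choose)) /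
    toF K0 n r h.choose_spec.choose ^ 2

/-- The logarithmic twist `∑_j s_j · (∂f_j/∂x_i)/f_j` in the fraction field. -/
def twist (f : Fin r → MvPolynomial (Fin n) K0) (i : Fin n) : Frac K0 n r :=
  ∑ j, toF K0 n r (X (Sum.inr j)) * toF K0 n r (px K0 n r (pderiv i (f j))) /
    toF K0 n r (px K0 n r (f j))

/-- The twisted partial derivative `∇_i(g·F^s) = (∂g/∂x_i + g·∑_j s_j (∂f_j/∂x_i)/f_j)·F^s`,
the formal action of `∂/∂x_i` on `g·f_1^{s_1}⋯f_r^{s_r}`; here `g·F^s` is identified with `g`. -/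
def nabla (f : Fin r → MvPolynomial (Fin n) K0) (i : Fin n) (g : Frac K0 n r) : Frac K0 n r :=
  DX K0 n r i g + g * twist K0 n r f i

/-- The element `F^{s+a} = (f_1^{a_1}⋯f_r^{a_r})·F^s`, where `F^s` is identified with `1`. -/
def Fsa (f : Fin r → MvPolynomial (Fin n) K0) (a : Fin r → ℕ) : Frac K0 n r :=
  toF K0 n r (∏ j, px K0 n r (f j) ^ a j)

/-- The smallest `K0[x,s]`-submodule containing `F^{s+a}` and stable under `∇_1,…,∇_n`,
realizing `𝒟[s]·F^{s+a}`. -/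
def Na (f : Fin r → MvPolynomial (Fin n) K0) (a : Fin r → ℕ) :
    Submodule (XS K0 n r) (Frac K0 n r) :=
  sInf {N | Fsa K0 n r f a ∈ N ∧ ∀ i : Fin n, ∀ m ∈ N, nabla K0 n r f i m ∈ N}

/-- The Bernstein–Sato ideal `B_F^a = { b ∈ K0[s] : b·F^s ∈ N_a }` (as a set of polynomials). -/
def BS (f : Fin r → MvPolynomial (Fin n) K0) (a : Fin r → ℕ) : Set (MvPolynomial (Fin r) K0) :=
  {b | toF K0 n r (ps K0 n r b) ∈ Na K0 n r f a}

/-- The zero locus `Z(B_F^a) ⊆ ℂ^r` of the Bernstein–Sato ideal. -/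
def ZBS (f : Fin r → MvPolynomial (Fin n) ℂ) (a : Fin r → ℕ) : Set (Fin r → ℂ) :=
  {α | ∀ b ∈ BS ℂ n r f a, eval α b = 0}

end

noncomputable section

section BinomialFunctional

/-- The generalized binomial coefficient `q (q - 1) ⋯ (q - k + 1) / k!`. -/
def binom (q : ℂ) : ℕ → ℂ
  | 0 => 1
  | k + 1 => binom q k * (q - k) / (k + 1)

/-- The generalized binomial coefficient with integer lower index, zero at negative indices. -/
def zbinom (q : ℂ) : ℤ → ℂ
  | .ofNat k => binom q k
  | .negSucc _ => 0

lemma binom_absorb (q : ℂ) (k : ℕ) : (k + 1) * binom q (k + 1) = (q - k) * binom q k := by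
  have : (k + 1 : ℂ) ≠ 0 := by exact_mod_cast k.succ_ne_zero
  rw [binom]
  field_simp

lemma binom_pascal (q : ℂ) (k : ℕ) :
    binom (q + 1) (k + 1) = binom q (k + 1) + binom q k := by
  induction k with
  | zero => simp [binom]
  | succ k ih =>
    have h : ((k + 1 : ℕ) + 1 : ℂ) ≠ 0 := by exact_mod_cast (k + 1).succ_ne_zero
    apply mul_left_cancel₀ h
    have h1 := binom_absorb (q + 1) (k + 1)
    have h2 := binom_absorb q (k + 1)
    have h3 := binom_absorb q k
    push_cast at *
    linear_combination h1 - h2 + (q - k) * ih - h3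

lemma binom_ne_zero {q : ℂ} (hq : ∀ k : ℕ, q ≠ k) (k : ℕ) : binom q k ≠ 0 := by
  induction k with
  | zero => simp [binom]
  | succ k ih =>
    rw [binom]
    exact div_ne_zero (mul_ne_zero ih (sub_ne_zero.2 (hq k))) (by exact_mod_cast k.succ_ne_zero)

lemma zbinom_natCast (q : ℂ) (k : ℕ) : zbinom q k = binom q k := rfl

lemma zbinom_of_neg (q : ℂ) {k : ℤ} (hk : k < 0) : zbinom q k = 0 := by
  obtain ⟨n, rfl⟩ := Int.eq_negSucc_of_lt_zero hk
  rfl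

lemma zbinom_zero (q : ℂ) : zbinom q 0 = 1 := rfl

lemma zbinom_absorb (q : ℂ) (k : ℤ) : k * zbinom q k = (q - k + 1) * zbinom q (k - 1) := by
  obtain hk | rfl | hk := lt_trichotomy k 0
  · rw [zbinom_of_neg q hk, zbinom_of_neg q (by lia)]
    simp
  · simp [zbinom_of_neg]
  · obtain ⟨n, rfl⟩ : ∃ n : ℕ, k = n + 1 := ⟨(k - 1).toNat, by lia⟩
    have := binom_absorb q n
    rw [add_sub_cancel_right, zbinom_natCast, ← Nat.cast_succ, zbinom_natCast]
    push_cast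
    linear_combination this

lemma zbinom_pascal (q : ℂ) (k : ℤ) :
    zbinom (q + 1) k = zbinom q k + zbinom q (k - 1) := by
  obtain hk | rfl | hk := lt_trichotomy k 0
  · rw [zbinom_of_neg _ hk, zbinom_of_neg _ hk, zbinom_of_neg q (by lia), add_zero]
  · simp [zbinom_of_neg, zbinom_zero]
  · obtain ⟨n, rfl⟩ : ∃ n : ℕ, k = n + 1 := ⟨(k - 1).toNat, by lia⟩
    rw [add_sub_cancel_right, zbinom_natCast, ← Nat.cast_succ, zbinom_natCast, zbinom_natCast]
    exact binom_pascal q n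

lemma mul_zbinom_sub_one (q : ℂ) (k : ℤ) :
    q * zbinom (q - 1) k = (q - k) * zbinom q k := by
  have h1 := zbinom_pascal (q - 1) k
  have h2 := zbinom_absorb (q - 1) k
  rw [sub_add_cancel] at h1
  linear_combination (k - q) * h1 + h2

/-- The value of the functional `res c` on the monomial `x ^ i * y ^ j`. -/
def resCoeff (c i j : ℕ) : ℂ :=
  zbinom (-c) (2 * c - 2 - i - j) * zbinom ((j - 1) / 2) (3 * c - 3 - i - j)

/-- The iterated residue at the origin, along one branch of the node, of
`P / (y ^ 2 - x ^ 2 + x ^ 3) ^ c`, up to a constant factor. -/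
def res (c : ℕ) : MvPolynomial (Fin 2) ℂ →ₗ[ℂ] ℂ :=
  (basisMonomials (Fin 2) ℂ).constr ℂ fun d => resCoeff c (d 0) (d 1)

lemma res_monomial (c i j : ℕ) : res c (X 0 ^ i * X 1 ^ j) = resCoeff c i j := by
  have h : (X 0 ^ i * X 1 ^ j : MvPolynomial (Fin 2) ℂ) =
      basisMonomials (Fin 2) ℂ (Finsupp.single 0 i + Finsupp.single 1 j) := by
    simp [X_pow_eq_monomial, monomial_mul]
  rw [h, res, Module.Basis.constr_basis]
  simp

lemma linearMap_ext_monomials {f g : MvPolynomial (Fin 2) ℂ →ₗ[ℂ] ℂ}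
    (h : ∀ i j : ℕ, f (X 0 ^ i * X 1 ^ j) = g (X 0 ^ i * X 1 ^ j)) : f = g := by
  refine (basisMonomials (Fin 2) ℂ).ext fun d => ?_
  have hd : basisMonomials (Fin 2) ℂ d = X 0 ^ d 0 * X 1 ^ d 1 := by
    simp [monomial_eq, Finsupp.prod_fintype]
  rw [hd]
  exact h _ _

/-- The cubic `y ^ 2 - x ^ 2 + x ^ 3` with a node at the origin. -/
def nodal : MvPolynomial (Fin 2) ℂ := X 1 ^ 2 - X 0 ^ 2 + X 0 ^ 3

lemma pderiv_zero_nodal : pderiv 0 nodal = -2 * X 0 + 3 * X 0 ^ 2 := by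
  simp [nodal, pderiv_X]

lemma pderiv_one_nodal : pderiv 1 nodal = 2 * X 1 := by
  simp [nodal, pderiv_X]

lemma res_nodal_mul (c : ℕ) (P : MvPolynomial (Fin 2) ℂ) :
    res (c + 1) (nodal * P) = res c P := by
  suffices h : (res (c + 1)).comp (LinearMap.mulLeft ℂ nodal) = res c from
    congrArg (fun f => f P) h
  refine linearMap_ext_monomials fun i j => ?_
  have h : nodal * (X 0 ^ i * X 1 ^ j) = X 0 ^ i * X 1 ^ (j + 2) - X 0 ^ (i + 2) * X 1 ^ j +
      X 0 ^ (i + 3) * X 1 ^ j := by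
    rw [nodal]
    ring
  simp only [LinearMap.comp_apply, LinearMap.mulLeft_apply, h, map_add, map_sub, res_monomial,
    resCoeff]
  push_cast
  have h1 := zbinom_pascal (-(c : ℂ) - 1) (2 * c - 2 - i - j)
  have h2 := zbinom_pascal (((j : ℂ) - 1) / 2) (3 * c - 2 - i - j)
  ring_nf at h1 h2 ⊢
  rw [h1, h2]
  ring

lemma res_nodal_pow_mul (c k : ℕ) (P : MvPolynomial (Fin 2) ℂ) :
    res (c + k) (nodal ^ k * P) = res c P := by
  induction k with
  | zero => simp
  | succ k ih => rw [← add_assoc, pow_succ', mul_assoc, res_nodal_mul, ih]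

lemma res_pderiv (c : ℕ) (i : Fin 2) (P : MvPolynomial (Fin 2) ℂ) :
    res (c + 1) (nodal * pderiv i P - (c : MvPolynomial (Fin 2) ℂ) * P * pderiv i nodal) = 0 := by
  rw [map_sub, res_nodal_mul]
  suffices h : (res c).comp (pderiv i : Derivation ℂ _ _).toLinearMap -
      (res (c + 1)).comp (LinearMap.mulLeft ℂ (C (c : ℂ) * pderiv i nodal)) = 0 by
    have h' := congrArg (fun f => f P) h
    simpa [mul_assoc, mul_comm, mul_left_comm] using h'
  refine linearMap_ext_monomials fun a b => ?_
  have hq := mul_zbinom_sub_one (-(c : ℂ)) (2 * c - 1 - a - b)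
  simp only [LinearMap.sub_apply, LinearMap.comp_apply, LinearMap.mulLeft_apply,
    Derivation.coeFn_coe, LinearMap.zero_apply]
  fin_cases i
  · have h1 : (pderiv 0 (X 0 ^ a * X 1 ^ b) : MvPolynomial (Fin 2) ℂ) =
        (a : ℂ) • (X 0 ^ (a - 1) * X 1 ^ b) := by
      simp [pderiv_X, smul_eq_C_mul]
      ring
    have h2 : (C (c : ℂ) * pderiv 0 nodal * (X 0 ^ a * X 1 ^ b) : MvPolynomial (Fin 2) ℂ) =
        (c : ℂ) • ((-2 : ℂ) • (X 0 ^ (a + 1) * X 1 ^ b) +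
          (3 : ℂ) • (X 0 ^ (a + 2) * X 1 ^ b)) := by
      simp only [pderiv_zero_nodal, smul_eq_C_mul, map_neg, map_ofNat]
      ring
    have h3 : (a : ℂ) * resCoeff c (a - 1) b = a * (zbinom (-c) (2 * c - 1 - a - b) *
        zbinom ((b - 1) / 2) (3 * c - 2 - a - b)) := by
      cases a with
      | zero => simp
      | succ a =>
        simp only [resCoeff, Nat.add_sub_cancel]
        push_cast
        ring_nf
    have hp := zbinom_pascal (-(c : ℂ) - 1) (2 * c - 1 - a - b)
    have hL := zbinom_absorb (((b : ℂ) - 1) / 2) (3 * c - 1 - a - b)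
    simp only [Fin.zero_eta, h1, h2, map_smul, map_add, res_monomial, smul_eq_mul, h3]
    simp only [resCoeff]
    push_cast at hq hp hL ⊢
    ring_nf at hq hp hL ⊢
    linear_combination
      (-2 * zbinom (-1 / 2 + b * (1 / 2)) (-1 + c * 3 - a - b) -
        3 * zbinom (-1 / 2 + b * (1 / 2)) (-2 + c * 3 - a - b)) * hq +
      3 * c * zbinom (-1 / 2 + b * (1 / 2)) (-2 + c * 3 - a - b) * hp +
      2 * zbinom (-c) (-1 + c * 2 - a - b) * hL
  · have h1 : (pderiv 1 (X 0 ^ a * X 1 ^ b) : MvPolynomial (Fin 2) ℂ) =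
        (b : ℂ) • (X 0 ^ a * X 1 ^ (b - 1)) := by
      simp [pderiv_X, smul_eq_C_mul]
      ring
    have h2 : (C (c : ℂ) * pderiv 1 nodal * (X 0 ^ a * X 1 ^ b) : MvPolynomial (Fin 2) ℂ) =
        (c : ℂ) • (2 : ℂ) • (X 0 ^ a * X 1 ^ (b + 1)) := by
      simp only [pderiv_one_nodal, smul_eq_C_mul, map_ofNat]
      ring
    have h3 : (b : ℂ) * resCoeff c a (b - 1) = b * (zbinom (-c) (2 * c - 1 - a - b) *
        zbinom ((b - 2) / 2) (3 * c - 2 - a - b)) := by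
      cases b with
      | zero => simp
      | succ b =>
        simp only [resCoeff, Nat.add_sub_cancel]
        push_cast
        ring_nf
    have hb := zbinom_absorb ((b : ℂ) / 2) (3 * c - 1 - a - b)
    have hb' := mul_zbinom_sub_one ((b : ℂ) / 2) (3 * c - 2 - a - b)
    simp only [Fin.mk_one, h1, h2, map_smul, res_monomial, smul_eq_mul, h3]
    simp only [resCoeff]
    push_cast at hq hb hb' ⊢
    ring_nf at hq hb hb' ⊢
    linear_combination 2 * zbinom (b * (1 / 2)) (-1 + c * 3 - a - b) * hq +
      2 * zbinom (-c) (-1 + c * 2 - a - b) * (hb' - hb)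

end BinomialFunctional

section Specialization

variable {K0 : Type} [Field K0] {n r : ℕ}

lemma toF_add (p q : XS K0 n r) : toF K0 n r (p + q) = toF K0 n r p + toF K0 n r q :=
  map_add _ _ _

lemma toF_mul (p q : XS K0 n r) : toF K0 n r (p * q) = toF K0 n r p * toF K0 n r q :=
  map_mul _ _ _

lemma toF_sub (p q : XS K0 n r) : toF K0 n r (p - q) = toF K0 n r p - toF K0 n r q :=
  map_sub (algebraMap (XS K0 n r) _) _ _

lemma toF_zero : toF K0 n r 0 = 0 :=
  map_zero (algebraMap (XS K0 n r) _)

lemma toF_one : toF K0 n r 1 = 1 :=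
  map_one (algebraMap (XS K0 n r) _)

lemma px_add (p q : MvPolynomial (Fin n) K0) : px K0 n r (p + q) = px K0 n r p + px K0 n r q :=
  map_add _ _ _

lemma px_sub (p q : MvPolynomial (Fin n) K0) : px K0 n r (p - q) = px K0 n r p - px K0 n r q :=
  map_sub (rename _) _ _

lemma px_mul (p q : MvPolynomial (Fin n) K0) : px K0 n r (p * q) = px K0 n r p * px K0 n r q :=
  map_mul _ _ _

lemma px_pow (p : MvPolynomial (Fin n) K0) (k : ℕ) : px K0 n r (p ^ k) = px K0 n r p ^ k :=
  map_pow _ _ _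

lemma px_zero : px K0 n r 0 = 0 :=
  map_zero (rename _)

lemma px_one : px K0 n r 1 = 1 :=
  map_one (rename _)

lemma toF_injective : Function.Injective (toF K0 n r) :=
  IsFractionRing.injective (XS K0 n r) (Frac K0 n r)

lemma toF_ne_zero {p : XS K0 n r} (hp : p ≠ 0) : toF K0 n r p ≠ 0 :=
  fun h => hp (toF_injective (h.trans toF_zero.symm))

lemma px_injective : Function.Injective (px K0 n r) :=
  rename_injective _ Sum.inl_injective

lemma px_ne_zero {p : MvPolynomial (Fin n) K0} (hp : p ≠ 0) : px K0 n r p ≠ 0 :=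
  fun h => hp (px_injective (h.trans px_zero.symm))

lemma pderiv_px (i : Fin n) (p : MvPolynomial (Fin n) K0) :
    pderiv (Sum.inl i) (px K0 n r p) = px K0 n r (pderiv i p) :=
  pderiv_rename Sum.inl_injective i p

lemma exists_toF_fraction (q : Frac K0 n r) :
    ∃ p d : XS K0 n r, d ≠ 0 ∧ q * toF K0 n r d = toF K0 n r p := by
  obtain ⟨p, d, hd, rfl⟩ := IsFractionRing.div_surjective (A := XS K0 n r) q
  have hd0 : d ≠ 0 := nonZeroDivisors.ne_zero hd
  exact ⟨p, d, hd0, div_mul_cancel₀ _ (toF_ne_zero hd0)⟩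

lemma DX_quotient (i : Fin n) {q : Frac K0 n r} {p d : XS K0 n r} (hd : d ≠ 0)
    (h : q * toF K0 n r d = toF K0 n r p) :
    DX K0 n r i q * toF K0 n r d =
      toF K0 n r (pderiv (Sum.inl i) p) - q * toF K0 n r (pderiv (Sum.inl i) d) := by
  have hq := IsFractionRing.div_surjective (A := XS K0 n r) q
  set p₀ := hq.choose with hp₀
  set d₀ := hq.choose_spec.choose with hd₀
  obtain ⟨hmem, heq⟩ : d₀ ∈ nonZeroDivisors (XS K0 n r) ∧ toF K0 n r p₀ / toF K0 n r d₀ = q :=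
    hq.choose_spec.choose_spec
  have hd0 : d₀ ≠ 0 := nonZeroDivisors.ne_zero hmem
  have hDX : DX K0 n r i q = (toF K0 n r (pderiv (Sum.inl i) p₀) * toF K0 n r d₀ -
      toF K0 n r p₀ * toF K0 n r (pderiv (Sum.inl i) d₀)) / toF K0 n r d₀ ^ 2 := rfl
  have hF := toF_ne_zero hd
  have hF₀ := toF_ne_zero hd0
  have hp : toF K0 n r p₀ = q * toF K0 n r d₀ := by rw [← heq, div_mul_cancel₀ _ hF₀]
  have hcross : p * d₀ = p₀ * d := by
    apply toF_injective
    rw [toF_mul, toF_mul, ← h, hp]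
    ring
  have hder := congrArg (fun t => toF K0 n r (pderiv (Sum.inl i) t)) hcross
  simp only [pderiv_mul, toF_add, toF_mul] at hder
  rw [hDX, div_mul_eq_mul_div, div_eq_iff (pow_ne_zero 2 hF₀)]
  rw [hp, ← h] at *
  linear_combination -toF K0 n r d₀ * hder

lemma DX_add (i : Fin n) (a b : Frac K0 n r) :
    DX K0 n r i (a + b) = DX K0 n r i a + DX K0 n r i b := by
  obtain ⟨p, d, hd, h⟩ := exists_toF_fraction a
  obtain ⟨p', d', hd', h'⟩ := exists_toF_fraction b
  have h1 := DX_quotient i hd h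
  have h2 := DX_quotient i hd' h'
  have h3 := DX_quotient i (q := a + b) (p := p * d' + p' * d) (mul_ne_zero hd hd') (by
    simp only [toF_add, toF_mul, ← h, ← h']
    ring)
  apply mul_right_cancel₀ (toF_ne_zero (mul_ne_zero hd hd'))
  rw [h3]
  simp only [map_add, pderiv_mul, toF_add, toF_mul, ← h, ← h']
  linear_combination -toF K0 n r d' * h1 - toF K0 n r d * h2

lemma DX_mul (i : Fin n) (a b : Frac K0 n r) :
    DX K0 n r i (a * b) = a * DX K0 n r i b + b * DX K0 n r i a := by
  obtain ⟨p, d, hd, h⟩ := exists_toF_fraction a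
  obtain ⟨p', d', hd', h'⟩ := exists_toF_fraction b
  have h1 := DX_quotient i hd h
  have h2 := DX_quotient i hd' h'
  have h3 := DX_quotient i (q := a * b) (p := p * p') (mul_ne_zero hd hd') (by
    simp only [toF_mul, ← h, ← h']
    ring)
  apply mul_right_cancel₀ (toF_ne_zero (mul_ne_zero hd hd'))
  rw [h3]
  simp only [pderiv_mul, toF_add, toF_mul, ← h, ← h']
  linear_combination -b * toF K0 n r d' * h1 - a * toF K0 n r d * h2

lemma DX_toF (i : Fin n) (p : XS K0 n r) :
    DX K0 n r i (toF K0 n r p) = toF K0 n r (pderiv (Sum.inl i) p) := by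
  simpa [toF_one, toF_zero] using
    DX_quotient i (q := toF K0 n r p) (p := p) one_ne_zero (by rw [toF_one, mul_one])

/-- `DX` as a derivation of the fraction field. -/
def DXDerivation (i : Fin n) : Derivation K0 (Frac K0 n r) (Frac K0 n r) :=
  Derivation.mk'
    { toFun := DX K0 n r i
      map_add' := DX_add i
      map_smul' := fun c q => by
        have hc : algebraMap K0 (Frac K0 n r) c = toF K0 n r (C c) :=
          IsScalarTower.algebraMap_apply K0 (XS K0 n r) _ c
        rw [Algebra.smul_def, DX_mul, hc, DX_toF, pderiv_C, toF_zero, mul_zero, add_zero,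
          RingHom.id_apply, Algebra.smul_def, hc] }
    (DX_mul i)

lemma DXDerivation_apply (i : Fin n) (q : Frac K0 n r) : DXDerivation i q = DX K0 n r i q := rfl

/-- Specialization of the parameters `s_j` to the values `α_j`. -/
def specialize (α : Fin r → K0) : XS K0 n r →ₐ[K0] MvPolynomial (Fin n) K0 :=
  aeval (Sum.elim X (C ∘ α))

lemma specialize_px (α : Fin r → K0) (p : MvPolynomial (Fin n) K0) :
    specialize α (px K0 n r p) = p := by
  rw [specialize, px, aeval_rename, Sum.elim_comp_inl, aeval_X_left_apply]

lemma specialize_ps (α : Fin r → K0) (p : MvPolynomial (Fin r) K0) :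
    specialize (n := n) α (ps K0 n r p) = C (eval α p) := by
  rw [specialize, ps, aeval_rename, Sum.elim_comp_inr]
  induction p using MvPolynomial.induction_on with
  | C a => simp [algebraMap_eq]
  | add p q hp hq => rw [map_add, map_add, map_add, hp, hq]
  | mul_X p i hp => rw [map_mul, map_mul, map_mul, hp, aeval_X, eval_X, Function.comp_apply]

/-- `SpecializesTo α q h` means that the fraction `q` has a denominator free of the parameters
`s_j`, and becomes `h` after the substitution `s = α`. -/
def SpecializesTo (α : Fin r → K0) (q h : Frac K0 n r) : Prop :=
  ∃ d : MvPolynomial (Fin n) K0, d ≠ 0 ∧ ∃ p : XS K0 n r,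
    q * toF K0 n r (px K0 n r d) = toF K0 n r p ∧
    h * toF K0 n r (px K0 n r d) = toF K0 n r (px K0 n r (specialize α p))

namespace SpecializesTo

variable {α : Fin r → K0} {q q' h h' : Frac K0 n r}

lemma add (H : SpecializesTo α q h) (H' : SpecializesTo α q' h') :
    SpecializesTo α (q + q') (h + h') := by
  obtain ⟨d, hd, p, h1, h2⟩ := H
  obtain ⟨d', hd', p', h1', h2'⟩ := H'
  refine ⟨d * d', mul_ne_zero hd hd', p * px K0 n r d' + p' * px K0 n r d, ?_, ?_⟩
  · simp only [px_mul, toF_mul, toF_add, ← h1, ← h1']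
    ring
  · simp only [map_add, map_mul, specialize_px, px_add, px_mul, toF_mul, toF_add, ← h2, ← h2']
    ring

lemma mul (H : SpecializesTo α q h) (H' : SpecializesTo α q' h') :
    SpecializesTo α (q * q') (h * h') := by
  obtain ⟨d, hd, p, h1, h2⟩ := H
  obtain ⟨d', hd', p', h1', h2'⟩ := H'
  refine ⟨d * d', mul_ne_zero hd hd', p * p', ?_, ?_⟩
  · simp only [px_mul, toF_mul, ← h1, ← h1']
    ring
  · simp only [map_mul, px_mul, toF_mul, ← h2, ← h2']
    ring

lemma of_poly (p : XS K0 n r) :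
    SpecializesTo α (toF K0 n r p) (toF K0 n r (px K0 n r (specialize α p))) :=
  ⟨1, one_ne_zero, p, by rw [px_one, toF_one, mul_one], by rw [px_one, toF_one, mul_one]⟩

lemma zero : SpecializesTo α (0 : Frac K0 n r) 0 := by
  simpa [px_zero, toF_zero] using of_poly (α := α) (0 : XS K0 n r)

lemma inv_px {d : MvPolynomial (Fin n) K0} (hd : d ≠ 0) :
    SpecializesTo α (toF K0 n r (px K0 n r d))⁻¹ (toF K0 n r (px K0 n r d))⁻¹ := by
  have hd' := inv_mul_cancel₀ (toF_ne_zero (px_ne_zero (r := r) hd))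
  exact ⟨d, hd, 1, by rw [hd', toF_one], by rw [hd', map_one, px_one, toF_one]⟩

lemma sum {ι : Type*} (s : Finset ι) {q h : ι → Frac K0 n r}
    (H : ∀ i ∈ s, SpecializesTo α (q i) (h i)) :
    SpecializesTo α (∑ i ∈ s, q i) (∑ i ∈ s, h i) := by
  classical
  induction s using Finset.induction_on with
  | empty => exact zero
  | insert a s ha ih =>
    rw [Finset.sum_insert ha, Finset.sum_insert ha]
    exact (H a (Finset.mem_insert_self a s)).add
      (ih fun i hi => H i (Finset.mem_insert_of_mem hi))

lemma deriv (H : SpecializesTo α q h) (i : Fin n) :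
    SpecializesTo α (DX K0 n r i q) (DX K0 n r i h) := by
  obtain ⟨d, hd, p, h1, h2⟩ := H
  have hd' := px_ne_zero (r := r) hd
  have e1 := DX_quotient i hd' h1
  have e2 := DX_quotient i hd' h2
  have hp : pderiv i (specialize α p) = specialize α (pderiv (Sum.inl i) p) :=
    (aeval_sumElim_pderiv_inl p α i).symm
  rw [pderiv_px] at e1 e2
  rw [pderiv_px, hp] at e2
  refine ⟨d * d, mul_ne_zero hd hd, pderiv (Sum.inl i) p * px K0 n r d -
    p * px K0 n r (pderiv i d), ?_, ?_⟩
  · simp only [px_mul, toF_mul, toF_sub, ← h1]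
    linear_combination toF K0 n r (px K0 n r d) * e1
  · simp only [map_sub, map_mul, specialize_px, px_sub, px_mul, toF_sub, toF_mul, ← h2]
    linear_combination toF K0 n r (px K0 n r d) * e2

lemma eq_specialize {p : XS K0 n r} (H : SpecializesTo α (toF K0 n r p) h) :
    h = toF K0 n r (px K0 n r (specialize α p)) := by
  obtain ⟨d, hd, p', h1, h2⟩ := H
  rw [← toF_mul] at h1
  apply mul_right_cancel₀ (toF_ne_zero (px_ne_zero (r := r) hd))
  rw [h2, ← toF_injective h1, map_mul, specialize_px, px_mul, toF_mul]

end SpecializesTo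

/-- The product `∏ f_j ^ α_j` for integer exponents. -/
def powProd (f : Fin r → MvPolynomial (Fin n) K0) (α : Fin r → ℤ) : Frac K0 n r :=
  ∏ j, toF K0 n r (px K0 n r (f j)) ^ α j

lemma DX_powProd {f : Fin r → MvPolynomial (Fin n) K0} (hf : ∀ j, f j ≠ 0) (α : Fin r → ℤ)
    (i : Fin n) :
    DX K0 n r i (powProd f α) = (∑ j, (α j : Frac K0 n r) *
      toF K0 n r (px K0 n r (pderiv i (f j))) / toF K0 n r (px K0 n r (f j))) * powProd f α := by
  unfold powProd
  generalize (Finset.univ : Finset (Fin r)) = s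
  classical
  induction s using Finset.induction_on with
  | empty =>
    rw [Finset.prod_empty, Finset.sum_empty, zero_mul]
    exact (DXDerivation i).map_one_eq_zero
  | insert a s ha ih =>
    have hz := toF_ne_zero (px_ne_zero (r := r) (hf a))
    have hp : DX K0 n r i (toF K0 n r (px K0 n r (f a)) ^ α a) = (α a : Frac K0 n r) *
        toF K0 n r (px K0 n r (pderiv i (f a))) / toF K0 n r (px K0 n r (f a)) *
        toF K0 n r (px K0 n r (f a)) ^ α a := by
      rw [← DXDerivation_apply, Derivation.leibniz_zpow, DXDerivation_apply, DX_toF, pderiv_px,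
        zsmul_eq_mul, smul_eq_mul, zpow_sub_one₀ hz]
      field_simp
    rw [Finset.prod_insert ha, Finset.sum_insert ha, DX_mul, hp, ih]
    ring

/-- Specializing `s` to an integer point `α` maps the module `Na` into every module of rational
functions in `x` that contains `F^(α+a)` and is stable under the partial derivatives. -/
theorem eval_mul_powProd_mem {f : Fin r → MvPolynomial (Fin n) K0} (hf : ∀ j, f j ≠ 0)
    {a : Fin r → ℕ} (α : Fin r → ℤ) (V : AddSubgroup (Frac K0 n r))
    (hmul : ∀ g, ∀ v ∈ V, toF K0 n r (px K0 n r g) * v ∈ V)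
    (hDX : ∀ i, ∀ v ∈ V, DX K0 n r i v ∈ V) (hFsa : Fsa K0 n r f a * powProd f α ∈ V)
    {b : MvPolynomial (Fin r) K0} (hb : b ∈ BS K0 n r f a) :
    toF K0 n r (px K0 n r (C (eval (fun j => (α j : K0)) b))) * powProd f α ∈ V := by
  set α' : Fin r → K0 := fun j => (α j : K0) with hα'
  let N : Submodule (XS K0 n r) (Frac K0 n r) :=
    { carrier := {q | ∃ h, SpecializesTo α' q h ∧ h * powProd f α ∈ V}
      add_mem' := by
        rintro q q' ⟨h, H, hV⟩ ⟨h', H', hV'⟩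
        exact ⟨h + h', H.add H', by rw [add_mul]; exact V.add_mem hV hV'⟩
      zero_mem' := ⟨0, SpecializesTo.zero, by rw [zero_mul]; exact V.zero_mem⟩
      smul_mem' := by
        rintro p q ⟨h, H, hV⟩
        refine ⟨toF K0 n r (px K0 n r (specialize α' p)) * h, ?_, ?_⟩
        · rw [Algebra.smul_def]
          exact (SpecializesTo.of_poly p).mul H
        · rw [mul_assoc]
          exact hmul _ _ hV }
  have hN : Na K0 n r f a ≤ N := by
    refine sInf_le ⟨?_, ?_⟩
    · refine ⟨Fsa K0 n r f a, ?_, hFsa⟩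
      have h := SpecializesTo.of_poly (α := α') (∏ j, px K0 n r (f j) ^ a j)
      have h' : px K0 n r (specialize α' (∏ j, px K0 n r (f j) ^ a j)) =
          ∏ j, px K0 n r (f j) ^ a j := by
        simp only [map_prod, map_pow, specialize_px]
        simp [px]
      rwa [h'] at h
    · rintro i q ⟨h, H, hV⟩
      refine ⟨DX K0 n r i h + h * ∑ j, (α j : Frac K0 n r) *
        toF K0 n r (px K0 n r (pderiv i (f j))) / toF K0 n r (px K0 n r (f j)), ?_, ?_⟩
      · refine (H.deriv i).add (H.mul (SpecializesTo.sum _ fun j _ => ?_))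
        rw [div_eq_mul_inv, div_eq_mul_inv]
        refine (SpecializesTo.mul ?_ ?_).mul (SpecializesTo.inv_px (hf j))
        · have h1 := SpecializesTo.of_poly (α := α') (X (Sum.inr j) : XS K0 n r)
          have h2 : toF K0 n r (px K0 n r (specialize α' (X (Sum.inr j)))) = α j := by
            simp [specialize, px, toF, hα']
          rwa [h2] at h1
        · simpa [specialize_px] using
            SpecializesTo.of_poly (α := α') (px K0 n r (pderiv i (f j)))
      · have := hDX i _ hV
        rw [DX_mul, DX_powProd hf] at this
        convert this using 1
        ring
  obtain ⟨h, H, hV⟩ := hN hb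
  rw [H.eq_specialize, specialize_ps] at hV
  exact hV

end Specialization

section Vanishing

/-- The embedding of `ℂ[x, y]` into the field of fractions of `ℂ[x, y, s₁, s₂]`. -/
def emb : MvPolynomial (Fin 2) ℂ →+* Frac ℂ 2 2 :=
  (algebraMap (XS ℂ 2 2) (Frac ℂ 2 2)).comp (rename Sum.inl : _ →ₐ[ℂ] XS ℂ 2 2).toRingHom

lemma toF_px (p : MvPolynomial (Fin 2) ℂ) : toF ℂ 2 2 (px ℂ 2 2 p) = emb p := rfl

lemma emb_injective : Function.Injective emb := toF_injective.comp px_injective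

lemma DX_emb (i : Fin 2) (p : MvPolynomial (Fin 2) ℂ) :
    DX ℂ 2 2 i (emb p) = emb (pderiv i p) := by
  rw [← toF_px, DX_toF, pderiv_px, toF_px]

lemma nodal_ne_zero : nodal ≠ 0 := by
  intro h
  have := congrArg (eval ![0, 1]) h
  simp [nodal] at this

/-- The polynomials in `x, y`, inside the field of fractions. -/
def polynomials : AddSubgroup (Frac ℂ 2 2) := emb.range.toAddSubgroup

/-- The quotients `Q / nodal ^ c` all of whose polynomial multiples have residue zero. -/
def residueFree : AddSubgroup (Frac ℂ 2 2) where
  carrier := {h | ∃ c Q, h * emb nodal ^ c = emb Q ∧ ∀ g, res c (g * Q) = 0}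
  zero_mem' := ⟨0, 0, by simp, by simp⟩
  neg_mem' := by
    rintro h ⟨c, Q, h1, h2⟩
    exact ⟨c, -Q, by rw [neg_mul, h1, map_neg], fun g => by rw [mul_neg, map_neg, h2, neg_zero]⟩
  add_mem' := by
    rintro h h' ⟨c, Q, h1, h2⟩ ⟨c', Q', h1', h2'⟩
    refine ⟨c + c', nodal ^ c' * Q + nodal ^ c * Q', ?_, fun g => ?_⟩
    · rw [map_add, map_mul, map_mul, ← h1, ← h1', map_pow, map_pow]
      ring
    · rw [mul_add, map_add, mul_left_comm, res_nodal_pow_mul, mul_left_comm, add_comm c c',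
        res_nodal_pow_mul, h2, h2', add_zero]

lemma emb_mul_mem_residueFree (g : MvPolynomial (Fin 2) ℂ) {h : Frac ℂ 2 2}
    (H : h ∈ residueFree) : emb g * h ∈ residueFree := by
  obtain ⟨c, Q, h1, h2⟩ := H
  refine ⟨c, g * Q, by rw [map_mul, ← h1, mul_assoc], fun g' => ?_⟩
  rw [← mul_assoc]
  exact h2 _

lemma DX_mem_residueFree (i : Fin 2) {h : Frac ℂ 2 2} (H : h ∈ residueFree) :
    DX ℂ 2 2 i h ∈ residueFree := by
  obtain ⟨c, Q, h1, h2⟩ := H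
  refine ⟨c + 1, nodal * pderiv i Q - (c : MvPolynomial (Fin 2) ℂ) * Q * pderiv i nodal, ?_,
    fun g => ?_⟩
  · have hd : px ℂ 2 2 (nodal ^ c) ≠ 0 := px_ne_zero (pow_ne_zero c nodal_ne_zero)
    have e := DX_quotient i (q := h) (p := px ℂ 2 2 Q) hd (by rw [toF_px, toF_px, map_pow, h1])
    rw [pderiv_px, pderiv_px, toF_px, toF_px, toF_px, map_pow] at e
    have e2 : emb (pderiv i (nodal ^ c)) * emb nodal =
        c * emb nodal ^ c * emb (pderiv i nodal) := by
      rw [← map_mul, Derivation.leibniz_pow]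
      cases c with
      | zero => simp
      | succ c =>
        simp only [nsmul_eq_mul, smul_eq_mul, Nat.add_sub_cancel, map_mul, map_pow, map_natCast]
        ring
    simp only [map_sub, map_mul, map_natCast, ← h1]
    linear_combination emb nodal * e - h * e2
  · have e := res_pderiv c i (g * Q)
    have e2 : g * (nodal * pderiv i Q - (c : MvPolynomial (Fin 2) ℂ) * Q * pderiv i nodal) =
        (nodal * pderiv i (g * Q) - (c : MvPolynomial (Fin 2) ℂ) * (g * Q) * pderiv i nodal) -
          nodal * (pderiv i g * Q) := by
      rw [Derivation.leibniz]
      simp only [smul_eq_mul]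
      ring
    rw [e2, map_sub, e, res_nodal_mul, h2, sub_zero]

lemma res_mul_eq_zero {c d : ℕ} (h : 2 * c < d + 2) (g : MvPolynomial (Fin 2) ℂ) :
    res c (g * X 1 ^ d) = 0 := by
  have : (res c).comp (LinearMap.mulRight ℂ (X 1 ^ d)) = 0 := by
    refine linearMap_ext_monomials fun i j => ?_
    rw [LinearMap.comp_apply, LinearMap.mulRight_apply, mul_assoc, ← pow_add, res_monomial,
      resCoeff, zbinom_of_neg _ (by lia), zero_mul, LinearMap.zero_apply]
  exact LinearMap.congr_fun this g

lemma resCoeff_ne_zero (m : ℕ) : resCoeff (m + 1) 0 (2 * m) ≠ 0 := by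
  have h1 : (2 * (m + 1 : ℕ) - 2 - (0 : ℕ) - (2 * m : ℕ) : ℤ) = 0 := by lia
  have h2 : (3 * (m + 1 : ℕ) - 3 - (0 : ℕ) - (2 * m : ℕ) : ℤ) = m := by lia
  rw [resCoeff, h1, h2, zbinom_zero, one_mul, zbinom_natCast]
  refine binom_ne_zero (fun k hk => ?_) m
  rw [div_eq_iff two_ne_zero] at hk
  have : ((2 * m : ℕ) : ℤ) - 1 = k * 2 := by exact_mod_cast hk
  lia

/-- The polynomials `y² - x² + x³` and `y`. -/
abbrev nodalLine : Fin 2 → MvPolynomial (Fin 2) ℂ := ![X 1 ^ 2 - X 0 ^ 2 + X 0 ^ 3, X 1]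

lemma nodalLine_ne_zero (j : Fin 2) : nodalLine j ≠ 0 := by
  fin_cases j
  · exact nodal_ne_zero
  · exact X_ne_zero 1

lemma Fsa_nodalLine : Fsa ℂ 2 2 nodalLine ![1, 2] = emb (nodal * X 1 ^ 2) := by
  simp [Fsa, Fin.prod_univ_two, ← toF_px, px_mul, px_pow, nodal]

lemma powProd_nodalLine (k l : ℤ) :
    powProd nodalLine ![k, l] = emb nodal ^ k * emb (X 1) ^ l := by
  simp [powProd, Fin.prod_univ_two, toF_px, nodal]

lemma eval_cast_pair (k l : ℤ) (b : MvPolynomial (Fin 2) ℂ) :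
    eval (fun j => ((![k, l] j : ℤ) : ℂ)) b = eval ![(k : ℂ), (l : ℂ)] b := by
  congr 2
  funext j
  fin_cases j <;> rfl

variable {b : MvPolynomial (Fin 2) ℂ}

lemma emb_nodal_ne_zero : emb nodal ≠ 0 := (map_ne_zero_iff emb emb_injective).2 nodal_ne_zero

lemma emb_X_ne_zero : emb (X 1) ≠ 0 := (map_ne_zero_iff emb emb_injective).2 (X_ne_zero 1)

lemma exists_polynomial_of_mem_BS (hb : b ∈ BS ℂ 2 2 nodalLine ![1, 2]) {k l : ℤ}
    (h1 : -1 ≤ k) (h2 : -2 ≤ l) :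
    ∃ Q, emb Q = emb (C (eval ![(k : ℂ), (l : ℂ)] b)) * (emb nodal ^ k * emb (X 1) ^ l) := by
  have := eval_mul_powProd_mem nodalLine_ne_zero ![k, l] polynomials
    (by rintro g _ ⟨Q, rfl⟩; exact ⟨g * Q, map_mul emb g Q⟩)
    (by rintro i _ ⟨Q, rfl⟩; exact ⟨pderiv i Q, (DX_emb i Q).symm⟩)
    (by
      obtain ⟨k', hk'⟩ := Int.eq_ofNat_of_zero_le (show 0 ≤ k + 1 by lia)
      obtain ⟨l', hl'⟩ := Int.eq_ofNat_of_zero_le (show 0 ≤ l + 2 by lia)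
      refine ⟨nodal ^ k' * X 1 ^ l', ?_⟩
      rw [Fsa_nodalLine, powProd_nodalLine, map_mul, map_mul, map_pow, map_pow, map_pow,
        ← zpow_natCast, ← zpow_natCast, ← hk', ← hl', zpow_add₀ emb_nodal_ne_zero,
        zpow_add₀ emb_X_ne_zero]
      norm_cast
      ring) hb
  rwa [eval_cast_pair, powProd_nodalLine] at this

lemma eval_eq_zero_of_nodal_pole (hb : b ∈ BS ℂ 2 2 nodalLine ![1, 2]) (m : ℕ) :
    eval ![-1, (m : ℂ)] b = 0 := by
  obtain ⟨Q, hQ⟩ := exists_polynomial_of_mem_BS hb (k := -1) (l := m) le_rfl (by lia)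
  have h := emb_injective (a₁ := Q * nodal) (a₂ := C (eval ![-1, (m : ℂ)] b) * X 1 ^ m) (by
    have := mul_inv_cancel₀ emb_nodal_ne_zero
    rw [map_mul, hQ, map_mul, map_pow]
    simp only [zpow_neg_one, zpow_natCast, Int.cast_neg, Int.cast_one, Int.cast_natCast]
    linear_combination emb (C (eval ![-1, (m : ℂ)] b)) * emb (X 1) ^ m * this)
  have := congrArg (eval ![-3, 6]) h
  norm_num [nodal] at this
  exact this

lemma eval_eq_zero_of_line_pole (hb : b ∈ BS ℂ 2 2 nodalLine ![1, 2]) (m : ℕ) {k : ℕ}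
    (hk : 1 ≤ k) (hk' : k ≤ 2) : eval ![(m : ℂ), -(k : ℂ)] b = 0 := by
  obtain ⟨Q, hQ⟩ := exists_polynomial_of_mem_BS hb (k := m) (l := -k) (by lia) (by lia)
  have h := emb_injective (a₁ := Q * X 1 ^ k)
      (a₂ := C (eval ![(m : ℂ), -(k : ℂ)] b) * nodal ^ m) (by
    have := mul_inv_cancel₀ (pow_ne_zero k emb_X_ne_zero)
    rw [map_mul, hQ, map_mul, map_pow, map_pow]
    simp only [zpow_neg, zpow_natCast, Int.cast_neg, Int.cast_natCast]
    linear_combination emb (C (eval ![(m : ℂ), -(k : ℂ)] b)) * emb nodal ^ m * this)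
  have := congrArg (eval ![2, 0]) h
  norm_num [nodal, (show k ≠ 0 by lia)] at this
  exact this

lemma eval_eq_zero_of_residue (hb : b ∈ BS ℂ 2 2 nodalLine ![1, 2]) (m : ℕ) {k : ℕ}
    (hk : 2 ≤ k) (hk' : k ≤ 5) : eval ![-((m + 3 : ℕ) : ℂ), 2 * ((m + 3 : ℕ) : ℂ) - k] b = 0 := by
  have := eval_mul_powProd_mem nodalLine_ne_zero ![-(m + 3 : ℕ), (2 * (m + 3) - k : ℕ)] residueFree
    (fun g v hv => emb_mul_mem_residueFree g hv) (fun i v hv => DX_mem_residueFree i hv)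
    ⟨m + 2, X 1 ^ (2 * (m + 3) - k + 2), by
      have := mul_inv_cancel₀ (pow_ne_zero (m + 3) emb_nodal_ne_zero)
      rw [Fsa_nodalLine, powProd_nodalLine, map_mul, map_pow, map_pow, zpow_neg, zpow_natCast,
        zpow_natCast]
      linear_combination emb (X 1) ^ (2 * (m + 3) - k + 2) * this,
      res_mul_eq_zero (by lia)⟩ hb
  rw [eval_cast_pair, powProd_nodalLine] at this
  obtain ⟨c, Q, h1, h2⟩ := this
  have e : ((-(m + 3 : ℕ) : ℤ) : ℂ) = -((m + 3 : ℕ) : ℂ) := by push_cast; ring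
  have e' : (((2 * (m + 3) - k : ℕ) : ℤ) : ℂ) = 2 * ((m + 3 : ℕ) : ℂ) - k := by
    rw [Int.cast_natCast, Nat.cast_sub (by lia)]
    push_cast
    ring
  rw [e, e'] at h1
  set β := eval ![-((m + 3 : ℕ) : ℂ), 2 * ((m + 3 : ℕ) : ℂ) - k] b
  have h := emb_injective (a₁ := Q * nodal ^ (m + 3))
    (a₂ := C β * X 1 ^ (2 * (m + 3) - k) * nodal ^ c) (by
      have := mul_inv_cancel₀ (pow_ne_zero (m + 3) emb_nodal_ne_zero)
      rw [map_mul, ← h1, map_mul, map_mul, map_pow, map_pow, map_pow, zpow_neg, zpow_natCast,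
        zpow_natCast, toF_px]
      linear_combination emb (C β) * emb (X 1) ^ (2 * (m + 3) - k) * emb nodal ^ c * this)
  have h3 := h2 (X 1 ^ (k - 2))
  rw [← res_nodal_pow_mul c (m + 3), show nodal ^ (m + 3) * (X 1 ^ (k - 2) * Q) =
    X 1 ^ (k - 2) * (Q * nodal ^ (m + 3)) by ring, h, show X 1 ^ (k - 2) *
      (C β * X 1 ^ (2 * (m + 3) - k) * nodal ^ c) = nodal ^ c *
      (C β * (X 0 ^ 0 * X 1 ^ ((k - 2) + (2 * (m + 3) - k)))) by ring, add_comm c,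
    res_nodal_pow_mul, ← smul_eq_C_mul, map_smul, res_monomial,
    show k - 2 + (2 * (m + 3) - k) = 2 * (m + 2) by lia, smul_eq_mul] at h3
  exact (mul_eq_zero.1 h3).resolve_right (resCoeff_ne_zero (m + 2))

end Vanishing

section Divisibility

/-- A bivariate polynomial with infinitely many zeros on a parametrized line is divisible by the
equation of that line. -/
lemma dvd_of_eval_line_eq_zero (p q : Polynomial ℂ) {u L c : MvPolynomial (Fin 2) ℂ}
    (h0 : L ∣ X 0 - Polynomial.aeval u p) (h1 : L ∣ X 1 - Polynomial.aeval u q) (N : ℕ)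
    (hc : ∀ m : ℕ, N ≤ m → eval ![p.eval (m : ℂ), q.eval (m : ℂ)] c = 0) : L ∣ c := by
  have hφ : aeval ![p, q] c = 0 := by
    apply Polynomial.eq_zero_of_infinite_isRoot
    refine Set.Infinite.mono (s := (fun m : ℕ => (m : ℂ)) '' Set.Ici N) ?_
      ((Set.Ici_infinite N).image Nat.cast_injective.injOn)
    rintro _ ⟨m, hm, rfl⟩
    have e : (Polynomial.aeval (m : ℂ)).comp (aeval ![p, q]) =
        aeval ![p.eval (m : ℂ), q.eval (m : ℂ)] := by
      ext i
      fin_cases i <;> simp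
    have := DFunLike.congr_fun e c
    rw [AlgHom.comp_apply, Polynomial.coe_aeval_eq_eval] at this
    rw [Set.mem_ofPred_eq, Polynomial.IsRoot.def, this, ← hc m hm, aeval_eq_eval]
  have e : (Ideal.Quotient.mkₐ ℂ (Ideal.span {L})).comp
      ((Polynomial.aeval u).comp (aeval ![p, q])) = Ideal.Quotient.mkₐ ℂ (Ideal.span {L}) := by
    ext i
    refine (Ideal.Quotient.eq.2 (Ideal.mem_span_singleton.2 ?_)).symm
    fin_cases i <;> simpa
  have := DFunLike.congr_fun e c
  rw [AlgHom.comp_apply, AlgHom.comp_apply, hφ, map_zero, map_zero] at this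
  exact Ideal.mem_span_singleton.1 (Ideal.Quotient.eq_zero_iff_mem.1 this.symm)

lemma mul_dvd_of_eval_line_eq_zero (p q : Polynomial ℂ) {u L P b : MvPolynomial (Fin 2) ℂ}
    (h0 : L ∣ X 0 - Polynomial.aeval u p) (h1 : L ∣ X 1 - Polynomial.aeval u q) (N : ℕ)
    (hb : ∀ m : ℕ, N ≤ m → eval ![p.eval (m : ℂ), q.eval (m : ℂ)] b = 0)
    (hP : ∀ m : ℕ, N ≤ m → eval ![p.eval (m : ℂ), q.eval (m : ℂ)] P ≠ 0) (h : P ∣ b) :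
    P * L ∣ b := by
  obtain ⟨c, rfl⟩ := h
  refine mul_dvd_mul_left P (dvd_of_eval_line_eq_zero p q h0 h1 N fun m hm => ?_)
  have := hb m hm
  rw [map_mul] at this
  exact (mul_eq_zero.1 this).resolve_left (hP m hm)

lemma mul_X_zero_add_one_dvd {P b : MvPolynomial (Fin 2) ℂ} (N : ℕ)
    (hb : ∀ m : ℕ, N ≤ m → eval ![-1, (m : ℂ)] b = 0)
    (hP : ∀ m : ℕ, N ≤ m → eval ![-1, (m : ℂ)] P ≠ 0) (h : P ∣ b) : P * (X 0 + 1) ∣ b :=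
  mul_dvd_of_eval_line_eq_zero (u := X 1) (-1) Polynomial.X (by simp) (by simp) N
    (by simpa using hb) (by simpa using hP) h

lemma mul_X_one_add_dvd {P b : MvPolynomial (Fin 2) ℂ} (N k : ℕ)
    (hb : ∀ m : ℕ, N ≤ m → eval ![(m : ℂ), -(k : ℂ)] b = 0)
    (hP : ∀ m : ℕ, N ≤ m → eval ![(m : ℂ), -(k : ℂ)] P ≠ 0) (h : P ∣ b) :
    P * (X 1 + (k : MvPolynomial (Fin 2) ℂ)) ∣ b :=
  mul_dvd_of_eval_line_eq_zero (u := X 0) Polynomial.X (-(k : Polynomial ℂ)) (by simp) (by simp) N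
    (by simpa using hb) (by simpa using hP) h

lemma mul_two_mul_X_zero_add_X_one_add_dvd {P b : MvPolynomial (Fin 2) ℂ} (N k : ℕ)
    (hb : ∀ m : ℕ, N ≤ m → eval ![-(m : ℂ), 2 * (m : ℂ) - k] b = 0)
    (hP : ∀ m : ℕ, N ≤ m → eval ![-(m : ℂ), 2 * (m : ℂ) - k] P ≠ 0) (h : P ∣ b) :
    P * (2 * X 0 + X 1 + (k : MvPolynomial (Fin 2) ℂ)) ∣ b :=
  mul_dvd_of_eval_line_eq_zero (u := -X 0) (-Polynomial.X) (2 * Polynomial.X - (k : Polynomial ℂ))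
    (by simp) (by
      refine dvd_of_eq ?_
      rw [map_sub, map_mul, map_ofNat, map_natCast, Polynomial.aeval_X]
      ring) N
    (by simpa using hb) (by simpa using hP) h

lemma dvd_of_mem_BS {b : MvPolynomial (Fin 2) ℂ} (hb : b ∈ BS ℂ 2 2 nodalLine ![1, 2]) :
    (X 0 + 1) * (X 1 + 1) * (X 1 + 2) * (2 * X 0 + X 1 + 2) * (2 * X 0 + X 1 + 3) *
      (2 * X 0 + X 1 + 4) * (2 * X 0 + X 1 + 5) ∣ b := by
  have key : ∀ {k : ℕ} {P : MvPolynomial (Fin 2) ℂ}, 2 ≤ k → k ≤ 5 →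
      (∀ m : ℕ, 5 ≤ m → eval ![-(m : ℂ), 2 * (m : ℂ) - k] P ≠ 0) → P ∣ b →
      P * (2 * X 0 + X 1 + (k : MvPolynomial (Fin 2) ℂ)) ∣ b := fun hk hk' hP h =>
    mul_two_mul_X_zero_add_X_one_add_dvd 5 _ (fun m hm => by
      obtain ⟨m, rfl⟩ := Nat.exists_eq_add_of_le' (show 3 ≤ m by lia)
      exact eval_eq_zero_of_residue hb m hk hk') hP h
  have e : ∀ {z : ℂ} (w : ℤ), z = w → w ≠ 0 → z ≠ 0 := by
    rintro _ w rfl hw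
    exact_mod_cast hw
  have h1 := mul_X_zero_add_one_dvd 5 (fun m _ => eval_eq_zero_of_nodal_pole hb m) (P := 1)
    (by simp) (one_dvd b)
  have h2 := mul_X_one_add_dvd 5 1
    (fun m _ => eval_eq_zero_of_line_pole hb m le_rfl one_le_two)
    (fun m hm => e (m + 1) (by simp) (by lia)) h1
  have h3 := mul_X_one_add_dvd 5 2
    (fun m _ => eval_eq_zero_of_line_pole hb m one_le_two le_rfl)
    (fun m hm => e (-(m + 1)) (by simp; ring) (by lia)) h2
  have h4 := key (k := 2) (by lia) (by lia) (fun m hm =>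
    e ((-m + 1) * (2 * m - 2 + 1) * (2 * m - 2 + 2)) (by simp)
      (mul_ne_zero (mul_ne_zero (by lia) (by lia)) (by lia))) h3
  have h5 := key (k := 3) (by lia) (by lia) (fun m hm =>
    e ((-m + 1) * (2 * m - 3 + 1) * (2 * m - 3 + 2) * (-1)) (by simp; ring)
      (mul_ne_zero (mul_ne_zero (mul_ne_zero (by lia) (by lia)) (by lia)) (by lia))) h4
  have h6 := key (k := 4) (by lia) (by lia) (fun m hm =>
    e ((-m + 1) * (2 * m - 4 + 1) * (2 * m - 4 + 2) * 2) (by simp; ring)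
      (mul_ne_zero (mul_ne_zero (mul_ne_zero (by lia) (by lia)) (by lia)) (by lia))) h5
  have h7 := key (k := 5) (by lia) (by lia) (fun m hm =>
    e ((-m + 1) * (2 * m - 5 + 1) * (2 * m - 5 + 2) * (-6)) (by simp; ring)
      (mul_ne_zero (mul_ne_zero (mul_ne_zero (by lia) (by lia)) (by lia)) (by lia))) h6
  simpa [one_mul] using h7

end Divisibility

section Membership

/-- The coordinate `x` in `ℂ[x, y, s₁, s₂]`. -/
abbrev varX : XS ℂ 2 2 := X (Sum.inl 0)

/-- The coordinate `y` in `ℂ[x, y, s₁, s₂]`. -/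
abbrev varY : XS ℂ 2 2 := X (Sum.inl 1)

/-- The parameter `s₁` in `ℂ[x, y, s₁, s₂]`. -/
abbrev varS : XS ℂ 2 2 := X (Sum.inr 0)

/-- The parameter `s₂` in `ℂ[x, y, s₁, s₂]`. -/
abbrev varT : XS ℂ 2 2 := X (Sum.inr 1)

/-- The polynomial `y² - x² + x³` in `ℂ[x, y, s₁, s₂]`. -/
abbrev nodalXS : XS ℂ 2 2 := varY ^ 2 - varX ^ 2 + varX ^ 3

lemma Fsa_mem_Na {K0 : Type} [Field K0] {n r : ℕ} (f : Fin r → MvPolynomial (Fin n) K0)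
    (a : Fin r → ℕ) : Fsa K0 n r f a ∈ Na K0 n r f a :=
  Submodule.mem_sInf.2 fun _ hN => hN.1

lemma nabla_mem_Na {K0 : Type} [Field K0] {n r : ℕ} {f : Fin r → MvPolynomial (Fin n) K0}
    {a : Fin r → ℕ} (i : Fin n) {m : Frac K0 n r} (hm : m ∈ Na K0 n r f a) :
    nabla K0 n r f i m ∈ Na K0 n r f a :=
  Submodule.mem_sInf.2 fun N hN => hN.2 i m (Submodule.mem_sInf.1 hm N hN)

/-- The ideal of those `g` with `g * F ^ s` in the module generated by `F ^ (s + a)`. -/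
def polyNa : Ideal (XS ℂ 2 2) :=
  (Na ℂ 2 2 nodalLine ![1, 2]).comap (Algebra.linearMap (XS ℂ 2 2) (Frac ℂ 2 2))

lemma mem_polyNa {g : XS ℂ 2 2} :
    g ∈ polyNa ↔ toF ℂ 2 2 g ∈ Na ℂ 2 2 nodalLine ![1, 2] := Iff.rfl

lemma px_nodal : px ℂ 2 2 nodal = nodalXS := by
  simp [px, nodal]

lemma pderiv_ps {K0 : Type} [Field K0] {n r : ℕ} (i : Fin n) (p : MvPolynomial (Fin r) K0) :
    pderiv (Sum.inl i) (ps K0 n r p) = 0 := by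
  apply pderiv_eq_zero_of_notMem_vars
  classical
  intro h
  have := vars_rename (Sum.inr : Fin r → Fin n ⊕ Fin r) p h
  simp at this

lemma mem_polyNa_of_divergence {g₀ g₁ g : XS ℂ 2 2} (h₀ : g₀ ∈ polyNa) (h₁ : g₁ ∈ polyNa)
    (h : nodalXS * varY * g = nodalXS * varY *
      (pderiv (Sum.inl 0) g₀ + pderiv (Sum.inl 1) g₁) +
      varS * varY * ((-2 * varX + 3 * varX ^ 2) * g₀ + 2 * varY * g₁) +
      varT * nodalXS * g₁) : g ∈ polyNa := by
  have hsum := add_mem (nabla_mem_Na 0 (mem_polyNa.1 h₀)) (nabla_mem_Na 1 (mem_polyNa.1 h₁))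
  have hf : toF ℂ 2 2 nodalXS ≠ 0 := by
    rw [← px_nodal]
    exact toF_ne_zero (px_ne_zero nodal_ne_zero)
  have hy : toF ℂ 2 2 varY ≠ 0 := toF_ne_zero (X_ne_zero _)
  have e₀ : px ℂ 2 2 (pderiv 0 nodal) = -2 * varX + 3 * varX ^ 2 := by
    rw [pderiv_zero_nodal]
    simp [px, map_ofNat (rename _)]
  have e₁ : px ℂ 2 2 (pderiv 1 nodal) = 2 * varY := by
    rw [pderiv_one_nodal]
    simp [px, map_ofNat (rename _)]
  have hX : px ℂ 2 2 (X 1) = varY := by simp [px]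
  have t₀ : twist ℂ 2 2 nodalLine 0 = toF ℂ 2 2 varS * toF ℂ 2 2 (-2 * varX + 3 * varX ^ 2) /
      toF ℂ 2 2 nodalXS := by
    rw [← e₀, ← px_nodal]
    simp [twist, Fin.sum_univ_two, px_zero, toF_zero, nodal]
  have t₁ : twist ℂ 2 2 nodalLine 1 = toF ℂ 2 2 varS * toF ℂ 2 2 (2 * varY) /
      toF ℂ 2 2 nodalXS + toF ℂ 2 2 varT / toF ℂ 2 2 varY := by
    rw [← e₁, ← px_nodal, ← hX]
    simp [twist, Fin.sum_univ_two, px_one, toF_one, nodal]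
  have e : toF ℂ 2 2 g = nabla ℂ 2 2 nodalLine 0 (toF ℂ 2 2 g₀) +
      nabla ℂ 2 2 nodalLine 1 (toF ℂ 2 2 g₁) := by
    apply mul_left_cancel₀ (mul_ne_zero hf hy)
    rw [nabla, nabla, DX_toF, DX_toF, t₀, t₁]
    rw [← toF_mul, ← toF_mul, h]
    generalize nodalXS = f at hf ⊢
    simp only [toF_add, toF_mul]
    field_simp
    ring
  rw [mem_polyNa, e]
  exact hsum

lemma mem_polyNa_of_combination {u v g : XS ℂ 2 2} (a b : XS ℂ 2 2) (k : ℕ) (hu : u ∈ polyNa)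
    (hv : v ∈ polyNa) (h : ((k + 1 : ℕ) : XS ℂ 2 2) * g = a * u + b * v) : g ∈ polyNa := by
  have e : C ((k + 1 : ℕ) : ℂ)⁻¹ * ((k + 1 : ℕ) : XS ℂ 2 2) = 1 := by
    rw [← map_natCast (C : ℂ →+* XS ℂ 2 2), ← C_mul, inv_mul_cancel₀, C_1]
    exact_mod_cast k.succ_ne_zero
  have : g = C ((k + 1 : ℕ) : ℂ)⁻¹ * (a * u + b * v) := by
    rw [← h, ← mul_assoc, e, one_mul]
  rw [this]
  exact polyNa.mul_mem_left _ (add_mem (polyNa.mul_mem_left a hu) (polyNa.mul_mem_left b hv))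

lemma pderiv_varX : pderiv (Sum.inl 0) varX = 1 ∧ pderiv (Sum.inl 1) varX = 0 :=
  ⟨pderiv_X_self _, pderiv_X_of_ne (by simp)⟩

lemma pderiv_varY : pderiv (Sum.inl 0) varY = 0 ∧ pderiv (Sum.inl 1) varY = 1 :=
  ⟨pderiv_X_of_ne (by simp), pderiv_X_self _⟩

lemma pderiv_varS (i : Fin 2) : pderiv (Sum.inl i) varS = 0 := pderiv_X_of_ne (by simp)

lemma pderiv_varT (i : Fin 2) : pderiv (Sum.inl i) varT = 0 := pderiv_X_of_ne (by simp)

lemma pderiv_two (i : Fin 2) : pderiv (Sum.inl i) (2 : XS ℂ 2 2) = 0 :=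
  (pderiv (Sum.inl i)).map_natCast 2

lemma pderiv_three (i : Fin 2) : pderiv (Sum.inl i) (3 : XS ℂ 2 2) = 0 :=
  (pderiv (Sum.inl i)).map_natCast 3

/-- All monomials of degree `d` in `x, y`, times `p(s₁, s₂)`, lie in `polyNa`. -/
def DegreeMem (d : ℕ) (p : MvPolynomial (Fin 2) ℂ) : Prop :=
  ∀ i j, i + j = d → ps ℂ 2 2 p * varX ^ i * varY ^ j ∈ polyNa

lemma DegreeMem.pred {d : ℕ} {p : MvPolynomial (Fin 2) ℂ} (h : DegreeMem (d + 1) p) :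
    DegreeMem d (p * (2 * X 0 + X 1 + ((d + 2 : ℕ) : MvPolynomial (Fin 2) ℂ))) := by
  rintro i j rfl
  have hx := h (i + 1) j (by lia)
  have hy := h i (j + 1) (by lia)
  have hE : ps ℂ 2 2 (p * (2 * X 0 + X 1 + ((i + j + 2 : ℕ) : MvPolynomial (Fin 2) ℂ))) =
      ps ℂ 2 2 p * (2 * varS + varT + (i + j + 2)) := by
    simp [ps, map_ofNat (rename _)]
  have hdiv : ps ℂ 2 2 p * varX ^ i * varY ^ j * (2 * (i + 1) - 2 * (i + 2) * varX +
      (2 - 3 * varX) * (2 * varS + varT + j + 1)) ∈ polyNa := by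
    refine mem_polyNa_of_divergence (polyNa.mul_mem_left (2 * (1 - varX)) hx)
      (polyNa.mul_mem_left (2 - 3 * varX) hy) ?_
    simp only [Derivation.leibniz, Derivation.leibniz_pow, map_sub, pderiv_ps, pderiv_varX,
      pderiv_varY, pderiv_two, pderiv_three, Derivation.map_one_eq_zero, smul_eq_mul,
      nsmul_eq_mul, Nat.add_sub_cancel]
    push_cast
    ring
  rw [hE]
  refine mem_polyNa_of_combination 1 (-(i - 1 - 3 * (2 * varS + varT + (i + j + 2)))) 1 hdiv hx ?_
  push_cast
  ring

lemma degreeMem_four :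
    DegreeMem 4 ((X 0 + 1) * (X 1 + 1) * (X 1 + 2)) := by
  have hps : ps ℂ 2 2 ((X 0 + 1) * (X 1 + 1) * (X 1 + 2)) =
      (varS + 1) * (varT + 1) * (varT + 2) := by
    simp [ps, map_ofNat (rename _)]
  have h1 : nodalXS * varY ^ 2 ∈ polyNa := by
    have := Fsa_mem_Na nodalLine ![1, 2]
    rw [Fsa_nodalLine, ← toF_px, px_mul, px_nodal, px_pow] at this
    simpa [px, mem_polyNa] using this
  have h2 : (varS + 1) * (-2 * varX + 3 * varX ^ 2) * varY ^ 2 ∈ polyNa := by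
    refine mem_polyNa_of_divergence h1 polyNa.zero_mem ?_
    simp only [Derivation.leibniz, Derivation.leibniz_pow, map_add, map_sub, map_zero, pderiv_varX,
      pderiv_varY, smul_eq_mul, nsmul_eq_mul]
    push_cast
    ring
  have h3 : (varS + 1) * (2 * varY ^ 3) + (varT + 2) * nodalXS * varY ∈ polyNa := by
    refine mem_polyNa_of_divergence polyNa.zero_mem h1 ?_
    simp only [Derivation.leibniz, Derivation.leibniz_pow, map_add, map_sub, map_zero, pderiv_varX,
      pderiv_varY, smul_eq_mul, nsmul_eq_mul]
    push_cast
    ring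
  have hy4 : (varS + 1) * varY ^ 4 ∈ polyNa :=
    mem_polyNa_of_combination varY (-(varT + 2)) 1 h3 h1 (by push_cast; ring)
  have h5 : (varS + 1) * varX ^ 2 * (1 - varX) * varY ^ 2 ∈ polyNa :=
    mem_polyNa_of_combination 1 (-(varS + 1)) 0 hy4 h1 (by push_cast; ring)
  have hxy2 : (varS + 1) * varX * varY ^ 2 ∈ polyNa :=
    mem_polyNa_of_combination 9 (3 * varX - 1) 1 h5 h2 (by push_cast; ring)
  have h6 : (varS + 1) * (varT + 2) * nodalXS * varX * varY ∈ polyNa :=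
    mem_polyNa_of_combination ((varS + 1) * varX) (-2 * (varS + 1) * varY) 0 h3 hxy2
      (by push_cast; ring)
  have h7 : (varS + 1) * (-2 * varY ^ 3 - (varT + 2) * varX ^ 2 * (2 - 3 * varX) * varY) ∈
      polyNa := by
    refine mem_polyNa_of_divergence (polyNa.mul_mem_left (-2 * varY) hxy2)
      (polyNa.mul_mem_left (-2 * varX + 3 * varX ^ 2) hxy2) ?_
    simp only [neg_mul, map_neg, Derivation.leibniz, Derivation.leibniz_pow, map_add,
      pderiv_varX, pderiv_varY, pderiv_varS, pderiv_two, pderiv_three, Derivation.map_one_eq_zero,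
      smul_eq_mul, nsmul_eq_mul]
    push_cast
    ring
  have h8 : (varS + 1) * (varT + 2) * varX ^ 3 * (2 - 3 * varX) * varY ∈ polyNa :=
    mem_polyNa_of_combination (-varX) (-2 * varY) 0 h7 hxy2 (by push_cast; ring)
  have h9 : (varS + 1) * (varT + 2) * varX ^ 3 * (1 - varX) * varY ∈ polyNa :=
    mem_polyNa_of_combination (-1) ((varT + 2) * varY) 0 h6 hxy2 (by push_cast; ring)
  have hx3y : (varS + 1) * (varT + 2) * varX ^ 3 * varY ∈ polyNa :=
    mem_polyNa_of_combination 3 (-1) 0 h9 h8 (by push_cast; ring)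
  have h11 : (varS + 1) * (varT + 2) * (-6 * varX ^ 2 * varY ^ 2 -
      (varT + 1) * varX ^ 4 * (2 - 3 * varX)) ∈ polyNa := by
    refine mem_polyNa_of_divergence (polyNa.mul_mem_left (-2 * varY) hx3y)
      (polyNa.mul_mem_left (-2 * varX + 3 * varX ^ 2) hx3y) ?_
    simp only [neg_mul, map_neg, Derivation.leibniz, Derivation.leibniz_pow, map_add,
      pderiv_varX, pderiv_varY, pderiv_varS, pderiv_varT, pderiv_two, pderiv_three,
      Derivation.map_one_eq_zero, smul_eq_mul, nsmul_eq_mul]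
    push_cast
    ring
  have h12 : (varS + 1) * (varT + 1) * (varT + 2) * varX ^ 4 * (2 - 3 * varX) ∈ polyNa :=
    mem_polyNa_of_combination (-1) (-6 * varX * (varT + 2)) 0 h11 hxy2 (by push_cast; ring)
  have h13 : (varS + 1) * (varT + 2) * (2 * varX * varY ^ 2 * (varS + 1) +
      (varT + 1) * nodalXS * varX) ∈ polyNa := by
    refine mem_polyNa_of_divergence polyNa.zero_mem h6 ?_
    simp only [Derivation.leibniz, Derivation.leibniz_pow, map_add, map_sub, map_zero,
      pderiv_varX, pderiv_varY, pderiv_varS, pderiv_varT, pderiv_two,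
      Derivation.map_one_eq_zero, smul_eq_mul, nsmul_eq_mul]
    push_cast
    ring
  have h14 : (varS + 1) * (varT + 1) * (varT + 2) * varX ^ 3 * (1 - varX) ∈ polyNa :=
    mem_polyNa_of_combination (-1)
      (2 * (varS + 1) * (varT + 2) + (varT + 1) * (varT + 2)) 0 h13 hxy2 (by push_cast; ring)
  have hx3 : (varS + 1) * (varT + 1) * (varT + 2) * varX ^ 3 ∈ polyNa :=
    mem_polyNa_of_combination (1 + 3 * varX) (-1) 0 h14 h12 (by push_cast; ring)
  intro i j hij
  rw [hps]
  obtain rfl : j = 4 - i := by lia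
  have hi : i ≤ 4 := by lia
  interval_cases i
  · exact mem_polyNa_of_combination ((varT + 1) * (varT + 2)) 0 0 hy4 hy4 (by push_cast; ring)
  · exact mem_polyNa_of_combination ((varT + 1) * (varT + 2) * varY) 0 0 hxy2 hxy2
      (by push_cast; ring)
  · exact mem_polyNa_of_combination ((varT + 1) * (varT + 2) * varX) 0 0 hxy2 hxy2
      (by push_cast; ring)
  · exact mem_polyNa_of_combination (varT + 1) 0 0 hx3y hx3y (by push_cast; ring)
  · exact mem_polyNa_of_combination varX 0 0 hx3 hx3 (by push_cast; ring)

lemma generator_mul_mem_BS (c : MvPolynomial (Fin 2) ℂ) :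
    (X 0 + 1) * (X 1 + 1) * (X 1 + 2) * (2 * X 0 + X 1 + 2) * (2 * X 0 + X 1 + 3) *
      (2 * X 0 + X 1 + 4) * (2 * X 0 + X 1 + 5) * c ∈ BS ℂ 2 2 nodalLine ![1, 2] := by
  have h := polyNa.mul_mem_left (ps ℂ 2 2 c) (degreeMem_four.pred.pred.pred.pred 0 0 rfl)
  have e : (X 0 + 1) * (X 1 + 1) * (X 1 + 2) * (2 * X 0 + X 1 + 2) * (2 * X 0 + X 1 + 3) *
      (2 * X 0 + X 1 + 4) * (2 * X 0 + X 1 + 5) * c = c * ((X 0 + 1) * (X 1 + 1) * (X 1 + 2) *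
      (2 * X 0 + X 1 + ((3 + 2 : ℕ) : MvPolynomial (Fin 2) ℂ)) *
      (2 * X 0 + X 1 + ((2 + 2 : ℕ) : MvPolynomial (Fin 2) ℂ)) *
      (2 * X 0 + X 1 + ((1 + 2 : ℕ) : MvPolynomial (Fin 2) ℂ)) *
      (2 * X 0 + X 1 + ((0 + 2 : ℕ) : MvPolynomial (Fin 2) ℂ))) := by
    push_cast
    ring
  rw [pow_zero, pow_zero, mul_one, mul_one, ps, ps, ← map_mul] at h
  rw [e]
  exact h

end Membership

/-- For `F = (y² - x² + x³, y) : ℂ² → ℂ²` and `a = (1,2)`, the Bernstein–Sato ideal `B_F^a` is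
the principal ideal generated by
`(s₁+1)(s₂+1)(s₂+2)(2s₁+s₂+2)(2s₁+s₂+3)(2s₁+s₂+4)(2s₁+s₂+5)`. -/
theorem stmt10 :
    BS ℂ 2 2 ![X 1 ^ 2 - X 0 ^ 2 + X 0 ^ 3, X 1] ![1, 2] =
      ↑(Ideal.span {(X 0 + 1) * (X 1 + 1) * (X 1 + 2) *
          (2 * X 0 + X 1 + 2) * (2 * X 0 + X 1 + 3) *
          (2 * X 0 + X 1 + 4) * (2 * X 0 + X 1 + 5)} :
        Ideal (MvPolynomial (Fin 2) ℂ)) := by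
  ext b
  rw [SetLike.mem_coe, Ideal.mem_span_singleton]
  refine ⟨dvd_of_mem_BS, ?_⟩
  rintro ⟨c, rfl⟩
  exact generator_mul_mem_BS c

end
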